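/- Correctness of radial Gaussianization for spherically symmetric distributions: Let X be a random vector in ℝ^p (p ≥ 1) whose law is invariant under every orthogonal transformation of ℝ^p, such that P(X = 0) = 0 and the cumulative distribution function F_r of the radius r = ‖X‖ is continuous. Let F_χ be the cumulative distribution function of the chi distribution with p degrees of freedom (the law of the norm of a standard p-dimensional Gaussian vector), and define t(r) = F_χ⁻¹(F_r(r)) using the generalized inverse F_χ⁻¹(u) = inf{s : F_χ(s) ≥ u}. Then the radially Gaussianized vector X_rg = (t(‖X‖)/‖X‖) · X follows the standard p-dimensional Gaussian distribution N(0, I_p). -/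

import Mathlib

open MeasureTheory ProbabilityTheory Matrix

/-- The Euclidean norm on `ℝ^p`. -/
noncomputable def euclNorm {p : ℕ} (x : Fin p → ℝ) : ℝ := Real.sqrt (∑ i, x i ^ 2)

/-- The standard Gaussian measure `N(0, I_p)` on `ℝ^p` (the p-fold product of `N(0,1)`). -/
noncomputable def stdGaussPi (p : ℕ) : Measure (Fin p → ℝ) :=
  Measure.pi fun _ : Fin p => gaussianReal 0 1

/-- The CDF `F_χ` of the chi distribution with `p` degrees of freedom, i.e. of the Euclidean
norm of a standard p-dimensional Gaussian vector. -/
noncomputable def chiCDF (p : ℕ) (s : ℝ) : ℝ := (stdGaussPi p {z | euclNorm z ≤ s}).toReal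


open Filter Topology Set

section Aux

variable {E : Type*} [NormedAddCommGroup E] [InnerProductSpace ℝ E] [FiniteDimensional ℝ E]
  [MeasurableSpace E] [BorelSpace E]

lemma aux_inv_charFun (μ : Measure E) (hμ : ∀ f : E ≃ₗᵢ[ℝ] E, μ.map f = μ) {x y : E}
    (h : ‖x‖ = ‖y‖) : charFun μ x = charFun μ y := by
  have key : ∀ f : E ≃ₗᵢ[ℝ] E, charFun μ (f x) = charFun μ x := by
    intro f
    conv_lhs => rw [← hμ f]
    rw [charFun_apply, integral_map f.continuous.measurable.aemeasurable
      (Measurable.aestronglyMeasurable (by fun_prop)), charFun_apply]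
    simp
  rw [← key (Submodule.reflection (Submodule.span ℝ {x - y})ᗮ), Submodule.reflection_sub h]

lemma aux_charFun_radial (μ σ : Measure E) [IsProbabilityMeasure μ] [IsProbabilityMeasure σ]
    (hμ : ∀ f : E ≃ₗᵢ[ℝ] E, μ.map f = μ) (hσ : ∀ f : E ≃ₗᵢ[ℝ] E, σ.map f = σ)
    (hσ1 : ∀ᵐ u ∂σ, ‖u‖ = 1) (e : E) (he : ‖e‖ = 1) (ξ : E) :
    charFun μ ξ = ∫ r, charFun σ ((‖ξ‖ * r) • e) ∂(μ.map (fun x => ‖x‖)) := by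
  have h1 : charFun μ ξ = ∫ u, charFun μ (‖ξ‖ • u) ∂σ := by
    have : ∀ᵐ u ∂σ, charFun μ (‖ξ‖ • u) = charFun μ ξ := by
      filter_upwards [hσ1] with u hu
      apply aux_inv_charFun μ hμ
      simp [norm_smul, hu]
    rw [integral_congr_ae this]
    simp
  have hint : Integrable (Function.uncurry fun (u x : E) =>
      Complex.exp ((inner ℝ x (‖ξ‖ • u) : ℝ) * Complex.I)) (σ.prod μ) := by
    refine Integrable.of_bound (C := 1) (Continuous.aestronglyMeasurable ?_) ?_
    · unfold Function.uncurry; fun_prop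
    · refine ae_of_all _ fun z => ?_
      simp [Function.uncurry, Complex.norm_exp_ofReal_mul_I]
  have hm : Continuous (charFun σ) := continuous_charFun
  rw [h1]
  simp_rw [charFun_apply (μ := μ)]
  rw [integral_integral_swap hint, integral_map (by fun_prop)
    (Continuous.aestronglyMeasurable (by fun_prop))]
  congr 1
  ext x
  have : charFun σ ((‖ξ‖ * ‖x‖) • e) = charFun σ (‖ξ‖ • x) := by
    apply aux_inv_charFun σ hσ
    simp [norm_smul, he]
  rw [this, charFun_apply]
  congr 1
  ext u
  simp [inner_smul_right, real_inner_comm]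

lemma aux_unique (μ ν σ : Measure E) [IsProbabilityMeasure μ] [IsProbabilityMeasure ν]
    [IsProbabilityMeasure σ]
    (hμ : ∀ f : E ≃ₗᵢ[ℝ] E, μ.map f = μ) (hν : ∀ f : E ≃ₗᵢ[ℝ] E, ν.map f = ν)
    (hσ : ∀ f : E ≃ₗᵢ[ℝ] E, σ.map f = σ)
    (hσ1 : ∀ᵐ u ∂σ, ‖u‖ = 1)
    (h : μ.map (fun x => ‖x‖) = ν.map (fun x => ‖x‖)) : μ = ν := by
  obtain ⟨e, he⟩ := hσ1.exists
  apply Measure.ext_of_charFun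
  ext ξ
  rw [aux_charFun_radial μ σ hμ hσ hσ1 e he, aux_charFun_radial ν σ hν hσ hσ1 e he, h]

/-- Equivariant radial maps preserve invariance. -/
lemma aux_map_inv (μ : Measure E) (hμ : ∀ f : E ≃ₗᵢ[ℝ] E, μ.map f = μ) (c : ℝ → ℝ)
    (hc : AEMeasurable (fun x : E => c ‖x‖ • x) μ) (f : E ≃ₗᵢ[ℝ] E) :
    (μ.map (fun x : E => c ‖x‖ • x)).map f = μ.map (fun x : E => c ‖x‖ • x) := by
  rw [AEMeasurable.map_map_of_aemeasurable f.continuous.measurable.aemeasurable hc]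
  have : (f ∘ fun x : E => c ‖x‖ • x) = (fun x : E => c ‖x‖ • x) ∘ f := by
    ext x; simp
  rw [this, ← AEMeasurable.map_map_of_aemeasurable (by rwa [hμ f])
    f.continuous.measurable.aemeasurable, hμ f]

end Aux

/-- Probability integral transform. -/
lemma aux_pit (ρ : Measure ℝ) [IsProbabilityMeasure ρ] (hc : Continuous (cdf ρ)) {u : ℝ}
    (h0 : 0 < u) (h1 : u < 1) : ρ.real {r | cdf ρ r ≤ u} = u := by
  have hmono := monotone_cdf ρ
  obtain ⟨b, hb⟩ := ((tendsto_cdf_atTop ρ).eventually (lt_mem_nhds h1)).exists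
  obtain ⟨b', hb'⟩ := ((tendsto_cdf_atBot ρ).eventually (gt_mem_nhds h0)).exists
  set S := {r | cdf ρ r ≤ u} with hS
  have hcl : IsClosed S := isClosed_le hc continuous_const
  have hne : S.Nonempty := ⟨b', hb'.le⟩
  have hbd : BddAbove S := ⟨b, fun r hr => by
    by_contra! h
    exact absurd (hmono h.le) (not_le.2 (lt_of_le_of_lt hr hb))⟩
  have ha : sSup S ∈ S := hcl.csSup_mem hne hbd
  have hSI : S = Iic (sSup S) := by
    ext r
    exact ⟨fun hr => le_csSup hbd hr, fun hr => (hmono hr).trans ha⟩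
  have hge : u ≤ cdf ρ (sSup S) := by
    have ht : Tendsto (cdf ρ) (𝓝[>] (sSup S)) (𝓝 (cdf ρ (sSup S))) :=
      hc.continuousAt.tendsto.mono_left nhdsWithin_le_nhds
    refine ge_of_tendsto ht ?_
    filter_upwards [self_mem_nhdsWithin] with r hr
    by_contra! h
    exact absurd (le_csSup hbd (show r ∈ S from h.le)) (not_le.2 hr)
  conv_lhs => rw [hSI]
  rw [← cdf_eq_real]
  exact le_antisymm ha hge

lemma aux_cdf_pos (ρ : Measure ℝ) [IsProbabilityMeasure ρ] (hc : Continuous (cdf ρ)) :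
    ∀ᵐ r ∂ρ, 0 < cdf ρ r := by
  have : ρ.real {r | cdf ρ r ≤ 0} = 0 := by
    refine le_antisymm (le_of_forall_gt_imp_ge_of_dense fun u hu => ?_) measureReal_nonneg
    have hm : (0:ℝ) < min u (1/2) := by positivity
    have := aux_pit ρ hc hm (lt_of_le_of_lt (min_le_right _ _) (by norm_num))
    calc ρ.real {r | cdf ρ r ≤ 0} ≤ ρ.real {r | cdf ρ r ≤ min u (1/2)} :=
          measureReal_mono (fun r (hr : _ ≤ _) => hr.trans hm.le)
      _ ≤ u := by rw [this]; exact min_le_left _ _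
  rw [ae_iff]
  simpa [measureReal_eq_zero_iff] using this

lemma aux_cdf_lt (ρ : Measure ℝ) [IsProbabilityMeasure ρ] (hc : Continuous (cdf ρ)) :
    ∀ᵐ r ∂ρ, cdf ρ r < 1 := by
  have hms : MeasurableSet {r | cdf ρ r < 1} := (isOpen_lt hc continuous_const).measurableSet
  have : ρ.real {r | cdf ρ r < 1} = 1 := by
    refine le_antisymm measureReal_le_one (le_of_forall_lt_imp_le_of_dense fun u hu => ?_)
    have hm : max u (1/2) < 1 := max_lt hu (by norm_num)
    have := aux_pit ρ hc (lt_of_lt_of_le (by norm_num) (le_max_right u (1/2))) hm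
    calc u ≤ max u (1/2) := le_max_left _ _
      _ = ρ.real {r | cdf ρ r ≤ max u (1/2)} := this.symm
      _ ≤ _ := measureReal_mono (fun r (hr : _ ≤ _) => lt_of_le_of_lt hr hm)
  have h2 : ρ {r | cdf ρ r < 1} = 1 := by
    rw [measureReal_def] at this
    rwa [ENNReal.toReal_eq_one_iff] at this
  exact (mem_ae_iff_prob_eq_one hms).2 h2

lemma aux_quantile_le (χ : Measure ℝ) {u s : ℝ} (h0 : 0 < u) (h1 : u < 1) :
    sInf {s : ℝ | u ≤ cdf χ s} ≤ s ↔ u ≤ cdf χ s := by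
  have hmono := monotone_cdf χ
  obtain ⟨b, hb⟩ := ((tendsto_cdf_atTop χ).eventually (lt_mem_nhds h1)).exists
  obtain ⟨b', hb'⟩ := ((tendsto_cdf_atBot χ).eventually (gt_mem_nhds h0)).exists
  have hne : {s : ℝ | u ≤ cdf χ s}.Nonempty := ⟨b, hb.le⟩
  have hbd : BddBelow {s : ℝ | u ≤ cdf χ s} := ⟨b', fun r hr => by
    by_contra! h
    exact absurd (hmono h.le) (not_le.2 (lt_of_lt_of_le hb' hr))⟩
  refine ⟨fun h => ?_, fun h => csInf_le hbd h⟩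
  have hr : Tendsto (cdf χ) (𝓝[>] s) (𝓝 (cdf χ s)) :=
    ((cdf χ).right_continuous s).tendsto.mono_left (nhdsWithin_mono _ Ioi_subset_Ici_self)
  refine ge_of_tendsto hr ?_
  filter_upwards [self_mem_nhdsWithin] with r hr
  obtain ⟨q, hq, hqr⟩ := exists_lt_of_csInf_lt hne (lt_of_le_of_lt h hr)
  exact le_trans hq (hmono hqr.le)

lemma aux_quantile_meas (ρ χ : Measure ℝ) [IsProbabilityMeasure ρ]
    (hc : Continuous (cdf ρ)) :
    AEMeasurable (fun r => sInf {s : ℝ | cdf ρ r ≤ cdf χ s}) ρ := by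
  have hms : MeasurableSet {r | 0 < cdf ρ r ∧ cdf ρ r < 1} :=
    ((isOpen_lt continuous_const hc).inter (isOpen_lt hc continuous_const)).measurableSet
  have hae : ∀ᵐ r ∂ρ, r ∈ {r | 0 < cdf ρ r ∧ cdf ρ r < 1} := by
    filter_upwards [aux_cdf_pos ρ hc, aux_cdf_lt ρ hc] with r h1 h2 using ⟨h1, h2⟩
  suffices h : MonotoneOn (fun r => sInf {s : ℝ | cdf ρ r ≤ cdf χ s})
      {r | 0 < cdf ρ r ∧ cdf ρ r < 1} by
    have h2 := aemeasurable_restrict_of_monotoneOn (μ := ρ) hms h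
    rwa [Measure.restrict_eq_self_of_ae_mem hae] at h2
  intro a ha b hb hab
  show sInf _ ≤ sInf _
  rw [aux_quantile_le χ ha.1 ha.2]
  exact (monotone_cdf ρ hab).trans ((aux_quantile_le χ hb.1 hb.2).1 le_rfl)

lemma aux_quantile_map (ρ χ : Measure ℝ) [IsProbabilityMeasure ρ] [IsProbabilityMeasure χ]
    (hc : Continuous (cdf ρ)) :
    ρ.map (fun r => sInf {s : ℝ | cdf ρ r ≤ cdf χ s}) = χ := by
  have hm := aux_quantile_meas ρ χ hc
  have := Measure.isProbabilityMeasure_map hm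
  apply Measure.eq_of_cdf
  ext s
  rw [cdf_eq_real, map_measureReal_apply_of_aemeasurable hm measurableSet_Iic]
  have : ρ.real ((fun r => sInf {s : ℝ | cdf ρ r ≤ cdf χ s}) ⁻¹' Iic s)
      = ρ.real {r | cdf ρ r ≤ cdf χ s} := by
    apply measureReal_congr
    filter_upwards [aux_cdf_pos ρ hc, aux_cdf_lt ρ hc] with r h1 h2
    exact propext (aux_quantile_le χ h1 h2)
  rw [this]
  rcases (cdf_nonneg χ s).eq_or_lt with h | h
  · rw [← h, measureReal_eq_zero_iff]
    have := aux_cdf_pos ρ hc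
    rw [ae_iff] at this
    simpa using this
  rcases (cdf_le_one χ s).eq_or_lt with h' | h'
  · rw [h']
    have : {r | cdf ρ r ≤ 1} = univ := eq_univ_of_forall fun r => cdf_le_one ρ r
    rw [this]; simp
  · exact aux_pit ρ hc h h'

lemma aux_main {E : Type*} [NormedAddCommGroup E] [InnerProductSpace ℝ E]
    [FiniteDimensional ℝ E] [MeasurableSpace E] [BorelSpace E]
    (μ ν : Measure E) [IsProbabilityMeasure μ] [IsProbabilityMeasure ν]
    (hμ : ∀ f : E ≃ₗᵢ[ℝ] E, μ.map f = μ) (hν : ∀ f : E ≃ₗᵢ[ℝ] E, ν.map f = ν)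
    (h0 : ∀ᵐ x ∂μ, x ≠ 0) (hc : Continuous (cdf (μ.map (fun x => ‖x‖)))) :
    AEMeasurable (fun x => (sInf {s : ℝ | cdf (μ.map (fun x => ‖x‖)) ‖x‖
      ≤ cdf (ν.map (fun x => ‖x‖)) s} / ‖x‖) • x) μ ∧
    μ.map (fun x => (sInf {s : ℝ | cdf (μ.map (fun x => ‖x‖)) ‖x‖
      ≤ cdf (ν.map (fun x => ‖x‖)) s} / ‖x‖) • x) = ν := by
  have hn : Measurable (fun x : E => ‖x‖) := measurable_norm
  have := Measure.isProbabilityMeasure_map (μ := μ) hn.aemeasurable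
  have := Measure.isProbabilityMeasure_map (μ := ν) hn.aemeasurable
  set ρ := μ.map (fun x => ‖x‖) with hρ
  set χ := ν.map (fun x => ‖x‖) with hχ
  set T : ℝ → ℝ := fun r => sInf {s : ℝ | cdf ρ r ≤ cdf χ s} with hT
  have hTm : AEMeasurable T ρ := aux_quantile_meas ρ χ hc
  have hTm' : AEMeasurable (fun x : E => T ‖x‖) μ := hTm.comp_measurable hn
  have hm : AEMeasurable (fun x : E => (T ‖x‖ / ‖x‖) • x) μ :=
    (hTm'.div hn.aemeasurable).smul aemeasurable_id
  refine ⟨hm, ?_⟩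
  have hm2 : AEMeasurable (fun x : E => (‖x‖⁻¹) • x) μ :=
    (hn.inv.smul measurable_id).aemeasurable
  have := Measure.isProbabilityMeasure_map hm
  have := Measure.isProbabilityMeasure_map hm2
  refine aux_unique _ ν (μ.map (fun x : E => (‖x‖⁻¹) • x))
    (aux_map_inv μ hμ (fun r => T r / r) hm) hν (aux_map_inv μ hμ (fun r => r⁻¹) hm2) ?_ ?_
  · refine (ae_map_iff hm2 (hn (measurableSet_singleton 1))).2 ?_
    filter_upwards [h0] with x hx
    simp [norm_smul, hx]
  · rw [AEMeasurable.map_map_of_aemeasurable hn.aemeasurable hm, ← hχ,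
      ← aux_quantile_map ρ χ hc, hρ, AEMeasurable.map_map_of_aemeasurable hTm hn.aemeasurable]
    apply Measure.map_congr
    have hTpos : ∀ᵐ x ∂μ, 0 ≤ T ‖x‖ := by
      have h1 : ∀ᵐ t ∂(ρ.map T), 0 ≤ t := by
        rw [aux_quantile_map ρ χ hc, hχ, ae_map_iff hn.aemeasurable measurableSet_Ici]
        exact ae_of_all _ fun x => norm_nonneg x
      exact ae_of_ae_map hn.aemeasurable (ae_of_ae_map hTm h1)
    filter_upwards [h0, hTpos] with x hx hTx
    have : ‖x‖ ≠ 0 := norm_ne_zero_iff.2 hx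
    show ‖(T ‖x‖ / ‖x‖) • x‖ = T ‖x‖
    rw [norm_smul, norm_div, norm_norm, div_mul_cancel₀ _ this, Real.norm_of_nonneg hTx]

lemma aux_euclNorm {p : ℕ} (x : Fin p → ℝ) : euclNorm x = ‖WithLp.toLp 2 x‖ := by
  simp [euclNorm, EuclideanSpace.norm_eq]

/-- Correctness of radial Gaussianization for spherically symmetric distributions:
if the law of `X` is invariant under every orthogonal transformation of `ℝ^p`, `P(X = 0) = 0`,
and the CDF `F_r` of the radius `‖X‖` is continuous, then with `t(r) = F_χ⁻¹(F_r(r))` the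
radially Gaussianized vector `X_rg = (t(‖X‖)/‖X‖) • X` follows `N(0, I_p)`. -/
theorem radial_gaussianization {Ω : Type*} [MeasureSpace Ω]
    [IsProbabilityMeasure (ℙ : Measure Ω)] {p : ℕ} (hp : 1 ≤ p)
    (X : Ω → Fin p → ℝ) (hX : Measurable X)
    (hsym : ∀ A ∈ Matrix.orthogonalGroup (Fin p) ℝ,
      Measure.map (fun ω => A *ᵥ X ω) ℙ = Measure.map X ℙ)
    (h0 : (ℙ : Measure Ω) {ω | X ω = 0} = 0)
    (hcont : Continuous fun s : ℝ => ((ℙ : Measure Ω) {ω | euclNorm (X ω) ≤ s}).toReal) :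
    Measure.map (fun ω =>
        (sInf {s : ℝ | ((ℙ : Measure Ω) {ω' | euclNorm (X ω') ≤ euclNorm (X ω)}).toReal ≤
            chiCDF p s} / euclNorm (X ω)) • X ω) ℙ =
      stdGaussPi p := by
  have hL : Measurable (WithLp.toLp 2 : (Fin p → ℝ) → EuclideanSpace ℝ (Fin p)) := by fun_prop
  have hL' : Measurable (WithLp.ofLp : EuclideanSpace ℝ (Fin p) → (Fin p → ℝ)) := by fun_prop
  have hn : Measurable (fun x : EuclideanSpace ℝ (Fin p) => ‖x‖) := measurable_norm
  have hLX : Measurable (fun ω => (WithLp.toLp 2 (X ω) : EuclideanSpace ℝ (Fin p))) :=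
    hL.comp hX
  set μ : Measure (EuclideanSpace ℝ (Fin p)) :=
    Measure.map (fun ω => WithLp.toLp 2 (X ω)) (ℙ : Measure Ω) with hμdef
  have : IsProbabilityMeasure μ := Measure.isProbabilityMeasure_map hLX.aemeasurable
  set ν := stdGaussian (EuclideanSpace ℝ (Fin p)) with hνdef
  have hνpi : (stdGaussPi p).map (WithLp.toLp 2) = ν := map_pi_eq_stdGaussian
  have := Measure.isProbabilityMeasure_map (μ := μ) hn.aemeasurable
  have := Measure.isProbabilityMeasure_map (μ := ν) hn.aemeasurable
  have hcdfρ : ∀ s, cdf (μ.map (fun x => ‖x‖)) s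
      = ((ℙ : Measure Ω) {ω | euclNorm (X ω) ≤ s}).toReal := by
    intro s
    rw [cdf_eq_real, measureReal_def, Measure.map_apply hn measurableSet_Iic,
      Measure.map_apply hLX (hn measurableSet_Iic)]
    simp only [aux_euclNorm]
    rfl
  have hcdfχ : ∀ s, cdf (ν.map (fun x => ‖x‖)) s = chiCDF p s := by
    intro s
    rw [cdf_eq_real, measureReal_def, Measure.map_apply hn measurableSet_Iic, ← hνpi,
      Measure.map_apply hL (hn measurableSet_Iic), chiCDF]
    simp only [aux_euclNorm]
    rfl
  have hμ : ∀ f : EuclideanSpace ℝ (Fin p) ≃ₗᵢ[ℝ] EuclideanSpace ℝ (Fin p), μ.map f = μ := by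
    intro f
    let b := EuclideanSpace.basisFun (Fin p) ℝ
    have hA := hsym _ (f.toMatrix_mem_unitaryGroup b b)
    have hAf : ∀ x : Fin p → ℝ, WithLp.toLp 2
        ((LinearMap.toMatrix b.toBasis b.toBasis f.toLinearEquiv.toLinearMap) *ᵥ x) = f (WithLp.toLp 2 x) := by
      intro x
      have := LinearMap.toMatrix_mulVec_repr b.toBasis b.toBasis f.toLinearEquiv.toLinearMap
        (WithLp.toLp 2 x)
      have hrepr : ⇑(b.toBasis.repr (WithLp.toLp 2 x)) = x := by
        ext i
        simp [b]
      rw [hrepr] at this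
      ext i
      simpa [b] using congrFun this i
    have h2 := congrArg (Measure.map (WithLp.toLp 2 : (Fin p → ℝ) → EuclideanSpace ℝ (Fin p))) hA
    rw [Measure.map_map hL hX, Measure.map_map hL (by
      have : Continuous fun x : Fin p → ℝ =>
        (LinearMap.toMatrix b.toBasis b.toBasis f.toLinearEquiv.toLinearMap) *ᵥ x := by fun_prop
      exact this.measurable.comp hX)] at h2
    rw [hμdef, Measure.map_map f.continuous.measurable hLX]
    refine Eq.trans ?_ h2
    congr 1
    ext ω : 1
    exact (hAf (X ω)).symm
  have h0' : ∀ᵐ x ∂μ, x ≠ 0 := by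
    refine (ae_map_iff hLX.aemeasurable (measurableSet_singleton 0).compl).2 ?_
    rw [ae_iff]
    simpa using h0
  have hc : Continuous (cdf (μ.map (fun x => ‖x‖))) := by
    convert hcont using 1
    ext s; exact hcdfρ s
  obtain ⟨hm, hmain⟩ := aux_main μ ν hμ (fun f => stdGaussian_map f) h0' hc
  have hback : stdGaussPi p = ν.map WithLp.ofLp := by
    rw [← hνpi, Measure.map_map hL' hL]
    exact Measure.map_id.symm
  have hm2 := hm
  rw [hμdef] at hm2
  rw [hback, ← hmain, AEMeasurable.map_map_of_aemeasurable hL'.aemeasurable hm, hμdef,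
    AEMeasurable.map_map_of_aemeasurable (hL'.comp_aemeasurable hm2) hLX.aemeasurable]
  congr 1
  ext ω : 1
  simp only [← hμdef, Function.comp, hcdfρ, hcdfχ, aux_euclNorm]
  rfl
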